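/- Let τ be a Hopf algebra automorphism of H with τ^m = Id. For any h¹, …, h^{m-1} ∈ H, one has Σ_(Λ) Λ₁h¹ ⊗ τ(Λ₂)h² ⊗ ⋯ ⊗ τ^{m-2}(Λ_{m-1})h^{m-1} ⊗ τ^{m-1}(Λ_m) = Σ_(Λ),(h¹) Λ₁ ⊗ τ(Λ₂S(h¹_{m-1}))h² ⊗ ⋯ ⊗ τ^{m-2}(Λ_{m-1}S(h¹₂))h^{m-1} ⊗ τ^{m-1}(Λ_m S(h¹₁)). -/

import Mathlib

open TensorProduct

noncomputable section

universe u

variable (k : Type u) [Field k]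

/-- `twistedMulMap τ n : h ↦ Σ h₁ · τ(h₂) · ⋯ · τⁿ(h_{n+1})`, the product of the `n+1`
Sweedler factors of the iterated comultiplication with the twist `τ` applied progressively. -/
def twistedMulMap (H : Type u) [Ring H] [HopfAlgebra k H] (τ : H →ₗ[k] H) :
    ℕ → (H →ₗ[k] H)
  | 0 => LinearMap.id
  | n + 1 => LinearMap.mul' k H ∘ₗ TensorProduct.map LinearMap.id (τ ∘ₗ twistedMulMap H τ n)
      ∘ₗ Coalgebra.comul (R := k)

/-- `powLM τ n` is the `n`-fold composition `τ ∘ ⋯ ∘ τ`. -/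
def powLM (H : Type u) [Ring H] [HopfAlgebra k H] (τ : H →ₗ[k] H) : ℕ → (H →ₗ[k] H)
  | 0 => LinearMap.id
  | n + 1 => τ ∘ₗ powLM H τ n

/-- Bundled `n`-fold tensor power `V ⊗ (V ⊗ (⋯ ⊗ k))`. -/
def TPc (V : Type u) [AddCommGroup V] [Module k V] : ℕ → ModuleCat.{u} k
  | 0 => ModuleCat.of k k
  | n + 1 => ModuleCat.of k (V ⊗[k] (TPc V n : Type u))

/-- The `n`-fold tensor power `V^{⊗n}` of `V` (with a trailing scalar factor). -/
abbrev TP (V : Type u) [AddCommGroup V] [Module k V] (n : ℕ) : Type u := (TPc k V n : Type u)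

variable (H : Type u) [Ring H] [HopfAlgebra k H]
variable (V : Type u) [AddCommGroup V] [Module k V]

/-- Append a vector at the end of a tensor power. -/
def TP.snoc : ∀ n, (TP k V n ⊗[k] V) →ₗ[k] TP k V (n + 1)
  | 0 => (TensorProduct.comm k k V).toLinearMap
  | n + 1 => (TensorProduct.map LinearMap.id (TP.snoc n)) ∘ₗ
      (TensorProduct.assoc k V (TP k V n) V).toLinearMap

/-- The cyclic shift `α : v₁ ⊗ v₂ ⊗ ⋯ ⊗ vₙ ↦ v₂ ⊗ ⋯ ⊗ vₙ ⊗ v₁`. -/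
def TP.cyc : ∀ n, TP k V n →ₗ[k] TP k V n
  | 0 => LinearMap.id
  | n + 1 => TP.snoc k V n ∘ₗ (TensorProduct.comm k V (TP k V n)).toLinearMap

/-- Apply `τ` to every tensor factor of `H^{⊗n}`. -/
def TP.mapAll (τ : H →ₗ[k] H) : ∀ n, TP k H n →ₗ[k] TP k H n
  | 0 => LinearMap.id
  | n + 1 => TensorProduct.map τ (TP.mapAll τ n)

/-- Twisted iterated comultiplication `h ↦ Σ h₁ ⊗ τ(h₂) ⊗ ⋯ ⊗ τ^{n-1}(hₙ)`. -/
def TP.dtw (τ : H →ₗ[k] H) : ∀ n, H →ₗ[k] TP k H n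
  | 0 => Coalgebra.counit (R := k)
  | n + 1 => TensorProduct.map LinearMap.id (TP.mapAll k H τ n ∘ₗ TP.dtw τ n) ∘ₗ
      Coalgebra.comul (R := k)

/-- Componentwise multiplication on the tensor powers of `H`. -/
def TP.mul : ∀ n, (TP k H n ⊗[k] TP k H n) →ₗ[k] TP k H n
  | 0 => LinearMap.mul' k k
  | n + 1 => TensorProduct.map (LinearMap.mul' k H) (TP.mul n) ∘ₗ
      (TensorProduct.tensorTensorTensorComm k H (TP k H n) H (TP k H n)).toLinearMap

/-- The map `h ↦ Σ τ(S(hₙ)) ⊗ τ²(S(h_{n-1})) ⊗ ⋯ ⊗ τⁿ(S(h₁))` on `n` Sweedler factors. -/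
def TP.phi (τ : H →ₗ[k] H) : ∀ n, H →ₗ[k] TP k H n
  | 0 => Coalgebra.counit (R := k)
  | n + 1 => TensorProduct.map (τ ∘ₗ HopfAlgebra.antipode (R := k))
        (TP.mapAll k H τ n ∘ₗ TP.phi τ n) ∘ₗ
      (TensorProduct.comm k H H).toLinearMap ∘ₗ Coalgebra.comul (R := k)

/-- Append the unit `1` of `H` as a last tensor factor. -/
def TP.appendOne (n : ℕ) : TP k H n →ₗ[k] TP k H (n + 1) :=
  TP.snoc k H n ∘ₗ (TensorProduct.mk k (TP k H n) H).flip 1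

/-- Prepend the unit `1` of `H` as a first tensor factor. -/
def TP.consOne (n : ℕ) : TP k H n →ₗ[k] TP k H (n + 1) :=
  TensorProduct.mk k H (TP k H n) 1

/-- The map `ψ : H̃^{⊗(n+1)} → H̃^{⊗(n+1)}` given by `ψ(h¹ ⊗ h² ⊗ ⋯ ⊗ h^{n+1}) =
Σ τ(S(h¹ₙ))h² ⊗ τ²(S(h¹_{n-1}))h³ ⊗ ⋯ ⊗ τⁿ(S(h¹₁))h^{n+1} ⊗ τ^{n+1}(S(h¹₁ ⋯ ))`, i.e. the
componentwise product of `Σ τ(S(h¹ₙ)) ⊗ ⋯ ⊗ τ^{n+1}(S(h¹₁))` with `h² ⊗ ⋯ ⊗ h^{n+1} ⊗ 1`. -/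
def TP.psi (τ : H →ₗ[k] H) (n : ℕ) : TP k H (n + 1) →ₗ[k] TP k H (n + 1) :=
  TP.mul k H (n + 1) ∘ₗ
    (TensorProduct.map (TP.phi k H τ (n + 1)) (TP.appendOne k H n) :
      H ⊗[k] TP k H n →ₗ[k] TP k H (n + 1) ⊗[k] TP k H (n + 1))

open Coalgebra WithConv in
/-- The comultiplication is the convolution product of the two inclusions `H → H ⊗ H`. -/
theorem HopfAlgebra.comul_eq_includeLeft_mul_includeRight :
    toConv (comul (R := k) (A := H)) =
      toConv (Algebra.TensorProduct.includeLeft : H →ₐ[k] H ⊗[k] H).toLinearMap *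
        toConv (Algebra.TensorProduct.includeRight : H →ₐ[k] H ⊗[k] H).toLinearMap := by
  let i₁ : H →ₐ[k] H ⊗[k] H := Algebra.TensorProduct.includeLeft
  let i₂ : H →ₐ[k] H ⊗[k] H := Algebra.TensorProduct.includeRight
  refine WithConv.ext (LinearMap.ext fun h => ?_)
  change comul (R := k) h =
    LinearMap.mul' k _ (TensorProduct.map i₁.toLinearMap i₂.toLinearMap (comul (R := k) h))
  induction comul (R := k) h with
  | zero => simp
  | tmul a b => simp [i₁, i₂]
  | add x y hx hy => simp only [map_add, ← hx, ← hy]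

open Coalgebra HopfAlgebra WithConv in
/-- The antipode is an anti-homomorphism of coalgebras. -/
theorem HopfAlgebra.comul_comp_antipode :
    comul (R := k) ∘ₗ antipode k (A := H) =
      TensorProduct.map (antipode k) (antipode k) ∘ₗ
        (TensorProduct.comm k H H).toLinearMap ∘ₗ comul (R := k) := by
  let i₁ : H →ₐ[k] H ⊗[k] H := Algebra.TensorProduct.includeLeft
  let i₂ : H →ₐ[k] H ⊗[k] H := Algebra.TensorProduct.includeRight
  have hswap : toConv (TensorProduct.map (antipode k) (antipode k) ∘ₗ
      (TensorProduct.comm k H H).toLinearMap ∘ₗ comul (R := k)) =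
      toConv (i₂.toLinearMap ∘ₗ antipode k) * toConv (i₁.toLinearMap ∘ₗ antipode k) := by
    refine WithConv.ext (LinearMap.ext fun h => ?_)
    change TensorProduct.map _ _ (TensorProduct.comm k H H (comul (R := k) h)) =
      LinearMap.mul' k _ (TensorProduct.map _ _ (comul (R := k) h))
    induction comul (R := k) h with
    | zero => simp
    | tmul a b => simp [i₁, i₂]
    | add x y hx hy => simp only [map_add, ← hx, ← hy]
  have hinv (i : H →ₐ[k] H ⊗[k] H) :
      toConv (i.toLinearMap ∘ₗ antipode k) * toConv i.toLinearMap = 1 := by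
    have h := LinearMap.algHom_comp_convMul_distrib i (toConv (antipode k)) (toConv LinearMap.id)
    rw [LinearMap.antipode_mul_id] at h
    refine (congrArg toConv h).symm.trans (WithConv.ext (LinearMap.ext fun h => ?_))
    exact i.commutes _
  refine WithConv.toConv_injective (left_inv_eq_right_inv ?_ LinearMap.comul_right_inv).symm
  rw [hswap, HopfAlgebra.comul_eq_includeLeft_mul_includeRight, mul_assoc,
    ← mul_assoc (toConv (i₁.toLinearMap ∘ₗ _)), hinv, one_mul, hinv]

open Coalgebra HopfAlgebra WithConv in
/-- For a right integral `Λ`, `Σ Λ₁h ⊗ Λ₂ = Σ Λ₁ ⊗ Λ₂S(h)`. -/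
theorem HopfAlgebra.comul_integral_mul_tmul_one (Λ : H)
    (hΛ : ∀ a : H, Λ * a = counit (R := k) a • Λ) (h : H) :
    comul (R := k) Λ * (h ⊗ₜ[k] 1) = comul (R := k) Λ * (1 ⊗ₜ[k] antipode k h) := by
  let i₁ : H →ₐ[k] H ⊗[k] H := Algebra.TensorProduct.includeLeft
  let i₂ : H →ₐ[k] H ⊗[k] H := Algebra.TensorProduct.includeRight
  let c := LinearMap.mulLeft k (comul (R := k) Λ)
  have hinv : toConv i₂.toLinearMap * toConv (i₂.toLinearMap ∘ₗ antipode k) = 1 := by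
    have h := LinearMap.algHom_comp_convMul_distrib i₂ (toConv LinearMap.id) (toConv (antipode k))
    rw [LinearMap.id_mul_antipode] at h
    refine (congrArg toConv h).symm.trans (WithConv.ext (LinearMap.ext fun h => ?_))
    exact i₂.commutes _
  have hassoc (f g : WithConv (H →ₗ[k] H ⊗[k] H)) :
      toConv (c ∘ₗ (f * g).ofConv) = toConv (c ∘ₗ f.ofConv) * g := by
    refine WithConv.ext (LinearMap.ext fun h => ?_)
    change comul (R := k) Λ * LinearMap.mul' k _ (TensorProduct.map _ _ (comul (R := k) h)) =
      LinearMap.mul' k _ (TensorProduct.map _ _ (comul (R := k) h))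
    induction comul (R := k) h with
    | zero => simp
    | tmul a b => simp [c, mul_assoc]
    | add x y hx hy => simp only [map_add, mul_add, hx, hy]
  have hintegral : toConv (c ∘ₗ (toConv i₁.toLinearMap * toConv i₂.toLinearMap).ofConv) =
      toConv (c ∘ₗ (1 : WithConv (H →ₗ[k] H ⊗[k] H)).ofConv) := by
    refine WithConv.ext (LinearMap.ext fun h => ?_)
    rw [← HopfAlgebra.comul_eq_includeLeft_mul_includeRight]
    change comul (R := k) Λ * comul (R := k) h =
      comul (R := k) Λ * algebraMap k _ (counit (R := k) h)
    rw [← Bialgebra.comul_mul, hΛ, map_smul, Algebra.algebraMap_eq_smul_one, mul_smul_comm,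
      mul_one]
  have key : toConv (c ∘ₗ i₁.toLinearMap) = toConv (c ∘ₗ i₂.toLinearMap ∘ₗ antipode k) := by
    have := congrArg (· * toConv (i₂.toLinearMap ∘ₗ antipode k)) hintegral
    simpa only [← hassoc, mul_assoc, hinv, mul_one, one_mul] using this
  exact LinearMap.congr_fun (toConv_injective key) h

namespace TP

variable {k H}

/-- Prepend a vector to a tensor power. -/
def cons {n : ℕ} (a : H) (x : TP k H n) : TP k H (n + 1) :=
  (a ⊗ₜ[k] x : H ⊗[k] TP k H n)

theorem mul_cons {n : ℕ} (a b : H) (x y : TP k H n) :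
    TP.mul k H (n + 1) (cons a x ⊗ₜ[k] cons b y) = cons (a * b) (TP.mul k H n (x ⊗ₜ[k] y)) := rfl

theorem succ_induction {n : ℕ} {p : TP k H (n + 1) → Prop} (zero : p 0)
    (tmul : ∀ (a : H) (x : TP k H n), p (cons a x))
    (add : ∀ x y, p x → p y → p (x + y)) (x : TP k H (n + 1)) : p x :=
  TensorProduct.induction_on (R := k) (M := H) (N := TP k H n) x zero tmul add

theorem mul_assoc (n : ℕ) (x y z : TP k H n) :
    TP.mul k H n (TP.mul k H n (x ⊗ₜ[k] y) ⊗ₜ[k] z) =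
      TP.mul k H n (x ⊗ₜ[k] TP.mul k H n (y ⊗ₜ[k] z)) := by
  induction n with
  | zero => exact _root_.mul_assoc (G := k) x y z
  | succ n ih =>
    induction x using succ_induction with
    | zero => simp only [zero_tmul, map_zero]
    | add x x' hx hx' => simp only [add_tmul, map_add, hx, hx']
    | tmul a x =>
    induction y using succ_induction with
    | zero => simp only [zero_tmul, tmul_zero, map_zero]
    | add y y' hy hy' => simp only [tmul_add, add_tmul, map_add, hy, hy']
    | tmul b y =>
    induction z using succ_induction with
    | zero => simp only [tmul_zero, map_zero]
    | add z z' hz hz' => simp only [tmul_add, map_add, hz, hz']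
    | tmul c z => simp only [mul_cons, ih, _root_.mul_assoc]

theorem mapAll_cons (τ : H →ₗ[k] H) (n : ℕ) (a : H) (x : TP k H n) :
    TP.mapAll k H τ (n + 1) (cons a x) = cons (τ a) (TP.mapAll k H τ n x) := rfl

theorem mapAll_mul (τ : H →ₗ[k] H) (hτ : ∀ a b : H, τ (a * b) = τ a * τ b) (n : ℕ)
    (x y : TP k H n) :
    TP.mapAll k H τ n (TP.mul k H n (x ⊗ₜ[k] y)) =
      TP.mul k H n (TP.mapAll k H τ n x ⊗ₜ[k] TP.mapAll k H τ n y) := by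
  induction n with
  | zero => rfl
  | succ n ih =>
    induction x using succ_induction with
    | zero => simp only [zero_tmul, map_zero]
    | add x x' hx hx' => simp only [add_tmul, map_add, hx, hx']
    | tmul a x =>
    induction y using succ_induction with
    | zero => simp only [tmul_zero, map_zero]
    | add y y' hy hy' => simp only [tmul_add, map_add, hy, hy']
    | tmul b y => simp only [mul_cons, mapAll_cons, ih, hτ]

theorem mul_map_id {n : ℕ} (f : H →ₗ[k] TP k H n)
    (hf : ∀ a b : H, f (a * b) = TP.mul k H n (f a ⊗ₜ[k] f b)) (x y : H ⊗[k] H) :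
    (TensorProduct.map LinearMap.id f (x * y) : H ⊗[k] TP k H n) =
      TP.mul k H (n + 1) ((TensorProduct.map LinearMap.id f x : H ⊗[k] TP k H n) ⊗ₜ[k]
        (TensorProduct.map LinearMap.id f y : H ⊗[k] TP k H n)) := by
  induction x with
  | zero => rw [zero_mul, map_zero]; exact (congrArg _ (zero_tmul _ _)).trans (map_zero _) |>.symm
  | add x x' hx hx' =>
    rw [add_mul, map_add, map_add, hx, hx']
    exact ((congrArg _ (add_tmul _ _ _)).trans (map_add _ _ _)).symm
  | tmul a a' =>
  induction y with
  | zero => rw [mul_zero, map_zero]; exact (congrArg _ (tmul_zero _ _)).trans (map_zero _) |>.symm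
  | add y y' hy hy' =>
    rw [mul_add, map_add, map_add, hy, hy']
    exact ((congrArg _ (tmul_add _ _ _)).trans (map_add _ _ _)).symm
  | tmul b b' =>
    simp only [Algebra.TensorProduct.tmul_mul_tmul, map_tmul, hf]
    rfl

theorem dtw_mul (τ : H →ₗ[k] H) (hτ : ∀ a b : H, τ (a * b) = τ a * τ b) (n : ℕ) (a b : H) :
    TP.dtw k H τ n (a * b) = TP.mul k H n (TP.dtw k H τ n a ⊗ₜ[k] TP.dtw k H τ n b) := by
  induction n generalizing a b with
  | zero => exact Bialgebra.counit_mul (R := k) (A := H) a b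
  | succ n ih =>
    have h := mul_map_id (TP.mapAll k H τ n ∘ₗ TP.dtw k H τ n)
      (fun a b => by simp only [LinearMap.comp_apply, ih, mapAll_mul τ hτ])
      (Coalgebra.comul (R := k) a) (Coalgebra.comul (R := k) b)
    rwa [← Bialgebra.comul_mul] at h

/-- Applying the twisted iterated comultiplication to an antipode yields `TP.phi`. -/
theorem mapAll_dtw_antipode (τ : H →ₗ[k] H) (n : ℕ) :
    TP.mapAll k H τ n ∘ₗ TP.dtw k H τ n ∘ₗ HopfAlgebra.antipode k = TP.phi k H τ n := by
  induction n with
  | zero => exact HopfAlgebra.counit_comp_antipode (R := k) (A := H)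
  | succ n ih =>
    calc (TensorProduct.map τ (TP.mapAll k H τ n) ∘ₗ
          TensorProduct.map LinearMap.id (TP.mapAll k H τ n ∘ₗ TP.dtw k H τ n)) ∘ₗ
          (Coalgebra.comul (R := k) ∘ₗ HopfAlgebra.antipode k)
      _ = (TensorProduct.map τ (TP.mapAll k H τ n) ∘ₗ
          TensorProduct.map LinearMap.id (TP.mapAll k H τ n ∘ₗ TP.dtw k H τ n) ∘ₗ
          TensorProduct.map (HopfAlgebra.antipode k) (HopfAlgebra.antipode k)) ∘ₗ
          (TensorProduct.comm k H H).toLinearMap ∘ₗ Coalgebra.comul (R := k) := by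
        rw [HopfAlgebra.comul_comp_antipode]; rfl
      _ = TensorProduct.map (τ ∘ₗ HopfAlgebra.antipode k) (TP.mapAll k H τ n ∘ₗ TP.phi k H τ n) ∘ₗ
          (TensorProduct.comm k H H).toLinearMap ∘ₗ Coalgebra.comul (R := k) := by
        rw [← TensorProduct.map_comp, ← TensorProduct.map_comp, LinearMap.id_comp,
          LinearMap.comp_assoc, ih]

theorem mul_map_id_tmul {n : ℕ} (f : H →ₗ[k] TP k H n) (z : H ⊗[k] H) (a : H) (y : TP k H n) :
    TP.mul k H (n + 1) ((TensorProduct.map LinearMap.id f z : H ⊗[k] TP k H n) ⊗ₜ[k]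
        (a ⊗ₜ[k] y : H ⊗[k] TP k H n)) =
      (TensorProduct.map LinearMap.id (TP.mul k H n ∘ₗ (TensorProduct.mk k _ _).flip y ∘ₗ f)
        (z * (a ⊗ₜ[k] 1)) : H ⊗[k] TP k H n) := by
  induction z with
  | zero => rw [zero_mul, map_zero, map_zero]; exact (congrArg _ (zero_tmul _ _)).trans (map_zero _)
  | add z z' hz hz' =>
    rw [add_mul, map_add, map_add, ← hz, ← hz']
    exact (congrArg _ (add_tmul _ _ _)).trans (map_add _ _ _)
  | tmul b b' =>
    simp only [Algebra.TensorProduct.tmul_mul_tmul, map_tmul, mul_one]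
    rfl

theorem map_id_mul_one_tmul {n : ℕ} (f : H →ₗ[k] TP k H n)
    (hf : ∀ a b : H, f (a * b) = TP.mul k H n (f a ⊗ₜ[k] f b)) (z : H ⊗[k] H) (b : H)
    (y : TP k H n) :
    TensorProduct.map LinearMap.id (TP.mul k H n ∘ₗ (TensorProduct.mk k _ _).flip y ∘ₗ f)
        (z * (1 ⊗ₜ[k] b)) =
      TensorProduct.map LinearMap.id
        (TP.mul k H n ∘ₗ (TensorProduct.mk k _ _).flip (TP.mul k H n (f b ⊗ₜ[k] y)) ∘ₗ f) z := by
  induction z with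
  | zero => rw [zero_mul, map_zero, map_zero]
  | add z z' hz hz' => rw [add_mul, map_add, map_add, hz, hz']
  | tmul c c' =>
    simp only [Algebra.TensorProduct.tmul_mul_tmul, map_tmul, mul_one, LinearMap.comp_apply, hf,
      LinearMap.flip_apply, TensorProduct.mk_apply, mul_assoc]

end TP

/-- **Theorem.** Let `H` be a finite-dimensional Hopf algebra over a field of characteristic `0`
with normalized two-sided integral `Λ`, and `τ` a Hopf algebra automorphism with `τ^m = Id`,
where `m = n + 2`.  For any `h¹, …, h^{m-1} ∈ H`,
`Σ Λ₁h¹ ⊗ τ(Λ₂)h² ⊗ ⋯ ⊗ τ^{m-2}(Λ_{m-1})h^{m-1} ⊗ τ^{m-1}(Λ_m)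
  = Σ Λ₁ ⊗ τ(Λ₂S(h¹_{m-1}))h² ⊗ ⋯ ⊗ τ^{m-2}(Λ_{m-1}S(h¹₂))h^{m-1} ⊗ τ^{m-1}(Λ_m S(h¹₁))`.
Both sides are the componentwise product in `H^{⊗m}` of `Σ Λ₁ ⊗ τ(Λ₂) ⊗ ⋯ ⊗ τ^{m-1}(Λ_m)`
with, respectively, `h¹ ⊗ ⋯ ⊗ h^{m-1} ⊗ 1` and `1 ⊗ ψ(h¹ ⊗ ⋯ ⊗ h^{m-1})`, as linear maps in
`h¹ ⊗ ⋯ ⊗ h^{m-1}`. -/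
theorem twisted_comul_of_integral_mul_eq_antipode_shift
    [CharZero k] [FiniteDimensional k H]
    (Λ : H)
    (hΛleft : ∀ a : H, a * Λ = Coalgebra.counit (R := k) a • Λ)
    (hΛright : ∀ a : H, Λ * a = Coalgebra.counit (R := k) a • Λ)
    (hΛone : Coalgebra.counit (R := k) Λ = 1)
    (n : ℕ)
    (τ : H →ₗ[k] H)
    (hτmul : ∀ a b : H, τ (a * b) = τ a * τ b) (hτone : τ 1 = 1)
    (hτcomul : Coalgebra.comul (R := k) ∘ₗ τ =
      TensorProduct.map τ τ ∘ₗ Coalgebra.comul (R := k))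
    (hτcounit : Coalgebra.counit (R := k) ∘ₗ τ = Coalgebra.counit (R := k))
    (hτord : powLM k H τ (n + 2) = LinearMap.id) :
    TP.mul k H (n + 2) ∘ₗ
        TensorProduct.mk k (TP k H (n + 2)) (TP k H (n + 2)) (TP.dtw k H τ (n + 2) Λ) ∘ₗ
        TP.appendOne k H (n + 1) =
      TP.mul k H (n + 2) ∘ₗ
        TensorProduct.mk k (TP k H (n + 2)) (TP k H (n + 2)) (TP.dtw k H τ (n + 2) Λ) ∘ₗ
        TP.consOne k H (n + 1) ∘ₗ TP.psi k H τ n := by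
  refine TensorProduct.ext (R := k) (M := H) (N := TP k H n) (LinearMap.ext₂ fun h x => ?_)
  let δ := TP.mapAll k H τ (n + 1) ∘ₗ TP.dtw k H τ (n + 1)
  have hδ (a b : H) : δ (a * b) = TP.mul k H (n + 1) (δ a ⊗ₜ[k] δ b) := by
    simp only [δ, LinearMap.comp_apply, TP.dtw_mul τ hτmul, TP.mapAll_mul τ hτmul]
  have hphi : δ (HopfAlgebra.antipode k h) = TP.phi k H τ (n + 1) h :=
    LinearMap.congr_fun (TP.mapAll_dtw_antipode τ (n + 1)) h
  let y := TP.appendOne k H n x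
  have hleft := TP.mul_map_id_tmul δ (Coalgebra.comul (R := k) Λ) h y
  have hright := TP.mul_map_id_tmul δ (Coalgebra.comul (R := k) Λ) 1
    (TP.mul k H (n + 1) (TP.phi k H τ (n + 1) h ⊗ₜ[k] y))
  rw [HopfAlgebra.comul_integral_mul_tmul_one k H Λ hΛright, TP.map_id_mul_one_tmul δ hδ,
    hphi] at hleft
  rw [← Algebra.TensorProduct.one_def, mul_one] at hright
  exact hleft.trans hright.symm

end
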